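/- There exists a regular set E ⊆ ℤ with 1/2 < D(E) < 1 such that for every integer λ, D(E + λE) < 1; in particular, E + λE = {a + λb : a, b ∈ E} has zero upper-Banach density for every λ ∈ ℤ, even though D(E) + D(E) > 1. (Hence in the Marstrand theorem for subsets of integers one cannot expect the full-measure set of parameters to contain integers.) -/

import Mathlib

open Filter MeasureTheory
open scoped ENNReal

noncomputable section

/-- The filter of intervals `(M, N]` of `ℤ` as the length `N - M` tends to infinity.
An interval is encoded by the pair `(M, N)`. -/
def intervalFilter : Filter (ℤ × ℤ) :=
  Filter.comap (fun p : ℤ × ℤ => p.2 - p.1) Filter.atTop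

/-- The number of elements of `E` in the interval `(M, N]`. -/
def icount (E : Set ℤ) (M N : ℤ) : ℕ := (E ∩ Set.Ioc M N).ncard

/-- The counting dimension of `E ⊆ ℤ`:
`D(E) = limsup_{|I| → ∞} log |E ∩ I| / log |I|`. -/
def countingDim (E : Set ℤ) : ℝ :=
  Filter.limsup
    (fun p : ℤ × ℤ => Real.log (icount E p.1 p.2) / Real.log ((p.2 - p.1 : ℤ) : ℝ))
    intervalFilter

/-- The counting `α`-measure of `E ⊆ ℤ`:
`H_α(E) = limsup_{|I| → ∞} |E ∩ I| / |I|^α`, with values in `[0, ∞]`. -/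
def countingMeasure (α : ℝ) (E : Set ℤ) : ℝ≥0∞ :=
  Filter.limsup
    (fun p : ℤ × ℤ =>
      ENNReal.ofReal ((icount E p.1 p.2 : ℝ) / ((p.2 - p.1 : ℤ) : ℝ) ^ α))
    intervalFilter

/-- The upper-Banach density of `E ⊆ ℤ`:
`d*(E) = limsup_{|I| → ∞} |E ∩ I| / |I|`. -/
def upperBanach (E : Set ℤ) : ℝ :=
  Filter.limsup
    (fun p : ℤ × ℤ => (icount E p.1 p.2 : ℝ) / ((p.2 - p.1 : ℤ) : ℝ))
    intervalFilter

/-- `E ⊆ ℤ` is regular if `0 < H_{D(E)}(E) < ∞`. -/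
def Regular (E : Set ℤ) : Prop :=
  0 < countingMeasure (countingDim E) E ∧ countingMeasure (countingDim E) E < ⊤

/-- Two (regular) sets `E, F ⊆ ℤ` are compatible if there are sequences of intervals
`I_n = (a n, b n]`, `J_n = (c n, d n]` with increasing lengths, `|I_n| ≍ |J_n|`,
`|E ∩ I_n| ≫ |I_n|^{D(E)}` and `|F ∩ J_n| ≫ |J_n|^{D(F)}`. -/
def Compatible (E F : Set ℤ) : Prop :=
  ∃ a b c d : ℕ → ℤ,
    (∀ n, a n < b n) ∧ (∀ n, c n < d n) ∧
    StrictMono (fun n => b n - a n) ∧ StrictMono (fun n => d n - c n) ∧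
    (∃ C : ℝ, 0 < C ∧ ∀ n,
      ((b n - a n : ℤ) : ℝ) ≤ C * ((d n - c n : ℤ) : ℝ) ∧
      ((d n - c n : ℤ) : ℝ) ≤ C * ((b n - a n : ℤ) : ℝ)) ∧
    (∃ c₁ : ℝ, 0 < c₁ ∧ ∀ n,
      c₁ * ((b n - a n : ℤ) : ℝ) ^ countingDim E ≤ (icount E (a n) (b n) : ℝ)) ∧
    (∃ c₂ : ℝ, 0 < c₂ ∧ ∀ n,
      c₂ * ((d n - c n : ℤ) : ℝ) ^ countingDim F ≤ (icount F (c n) (d n) : ℝ))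

/-- The arithmetic sum `E + ⌊λ F⌋ = {a + ⌊λ b⌋ : a ∈ E, b ∈ F}`. -/
def sumFloor (E F : Set ℤ) (l : ℝ) : Set ℤ :=
  {n : ℤ | ∃ a ∈ E, ∃ b ∈ F, n = a + ⌊l * (b : ℝ)⌋}

/-- The set of residues modulo `2 ^ n` of the elements of `S`. -/
def residues (S : Set ℤ) (n : ℕ) : Set ℤ := (fun x => x % 2 ^ n) '' S

theorem residues_finite (S : Set ℤ) (n : ℕ) : (residues S n).Finite := by
  refine (Set.finite_Ico (0 : ℤ) (2 ^ n)).subset ?_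
  rintro _ ⟨x, -, rfl⟩
  exact ⟨Int.emod_nonneg _ (by positivity), Int.emod_lt_of_pos _ (by positivity)⟩

theorem ncard_residues_zero_le (S : Set ℤ) : (residues S 0).ncard ≤ 1 := by
  have h : residues S 0 ⊆ {0} := by
    rintro _ ⟨x, -, rfl⟩
    simp
  simpa using Set.ncard_le_ncard h

theorem ncard_residues_succ_le (S : Set ℤ) (n : ℕ) :
    (residues S (n + 1)).ncard ≤ 2 * (residues S n).ncard := by
  have h : residues S (n + 1) ⊆ residues S n ∪ (fun r => r + 2 ^ n) '' residues S n := by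
    rintro _ ⟨x, hx, rfl⟩
    have hpos : (0 : ℤ) < 2 ^ n := by positivity
    have hx0 := Int.emod_nonneg x (b := 2 ^ (n + 1)) (by positivity)
    have hx1 := Int.emod_lt_of_pos x (b := 2 ^ (n + 1)) (by positivity)
    have hmod : x % 2 ^ (n + 1) % 2 ^ n = x % 2 ^ n :=
      Int.emod_emod_of_dvd _ (pow_dvd_pow _ n.le_succ)
    rcases lt_or_ge (x % 2 ^ (n + 1)) (2 ^ n) with hlt | hge
    · refine Or.inl ⟨x, hx, ?_⟩
      simpa [Int.emod_eq_of_lt hx0 hlt] using hmod.symm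
    · refine Or.inr ⟨_, ⟨x, hx, rfl⟩, ?_⟩
      have : (x % 2 ^ (n + 1) - 2 ^ n) % 2 ^ n = x % 2 ^ n := by
        rw [Int.sub_emod_right, hmod]
      rw [pow_succ] at hx1 this hge ⊢
      rw [Int.emod_eq_of_lt (by linarith) (by linarith)] at this
      simp only
      linarith
  calc _ ≤ _ := Set.ncard_le_ncard h
        ((residues_finite S n).union ((residues_finite S n).image _))
    _ ≤ _ := Set.ncard_union_le _ _
    _ ≤ _ := by
      have := Set.ncard_image_le (f := fun r : ℤ => r + 2 ^ n) (residues_finite S n)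
      omega

theorem ncard_residues_add_le (S : Set ℤ) (n q : ℕ) :
    (residues S (n + q)).ncard ≤ 2 ^ q * (residues S n).ncard := by
  induction q with
  | zero => simp
  | succ q ih =>
    calc _ ≤ _ := ncard_residues_succ_le S (n + q)
      _ ≤ 2 * (2 ^ q * (residues S n).ncard) := by gcongr
      _ = _ := by ring

/-- A set meets an interval of length at most `2 ^ n` in at most as many points as it has
residues modulo `2 ^ n`. -/
theorem icount_le_ncard_residues (S : Set ℤ) {M N : ℤ} {n : ℕ} (h : N - M ≤ 2 ^ n) :
    icount S M N ≤ (residues S n).ncard := by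
  refine Set.ncard_le_ncard_of_injOn (fun x => x % 2 ^ n) (fun x hx => ⟨x, hx.1, rfl⟩) ?_
    (residues_finite S n)
  rintro x ⟨-, hx⟩ y ⟨-, hy⟩ hxy
  obtain ⟨c, hc⟩ := Int.ModEq.dvd (show x ≡ y [ZMOD 2 ^ n] from hxy)
  have hlt : |y - x| < 2 ^ n := by
    rw [abs_lt]
    constructor <;> linarith [hx.1, hx.2, hy.1, hy.2]
  have := Int.eq_zero_of_abs_lt_dvd ⟨c, hc⟩ hlt
  linarith

theorem icount_le_mul_rpow {S : Set ℤ} {C β : ℝ} (hβ0 : 0 ≤ β) (hβ1 : β ≤ 1)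
    (hS : ∀ n : ℕ, ((residues S n).ncard : ℝ) ≤ C * (2 : ℝ) ^ (β * n)) {M N : ℤ} (hMN : M < N) :
    (icount S M N : ℝ) ≤ 2 * C * ((N - M : ℤ) : ℝ) ^ β := by
  have hC : 0 ≤ C := by
    have := hS 0
    simp only [Nat.cast_zero, mul_zero, Real.rpow_zero, mul_one] at this
    exact (Nat.cast_nonneg _).trans this
  obtain ⟨L, hL⟩ := Int.eq_ofNat_of_zero_le (sub_pos.2 hMN).le
  have hL0 : 0 < L := by omega
  obtain ⟨n, hn, hn'⟩ : ∃ n : ℕ, L ≤ 2 ^ n ∧ 2 ^ n ≤ 2 * L := by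
    refine ⟨Nat.clog 2 L, Nat.le_pow_clog one_lt_two _, ?_⟩
    rcases Nat.lt_or_ge 1 L with h1 | h1
    · have h2 := Nat.pow_pred_clog_lt_self one_lt_two h1
      have h3 := Nat.clog_pos one_lt_two h1
      obtain ⟨k, hk⟩ := Nat.exists_eq_succ_of_ne_zero h3.ne'
      rw [hk] at h2 ⊢
      simp only [Nat.pred_succ, Nat.succ_eq_add_one, pow_succ] at h2 ⊢
      omega
    · rw [Nat.clog_of_right_le_one h1]
      simp
      omega
  have h1 : (icount S M N : ℝ) ≤ C * (2 : ℝ) ^ (β * n) := by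
    refine le_trans ?_ (hS n)
    exact_mod_cast icount_le_ncard_residues S (by rw [hL]; exact_mod_cast hn)
  have h2 : (2 : ℝ) ^ (β * n) ≤ 2 * (L : ℝ) ^ β := by
    calc (2 : ℝ) ^ (β * n) = ((2 : ℝ) ^ n) ^ β := by
          rw [mul_comm, Real.rpow_mul (by norm_num), Real.rpow_natCast]
      _ ≤ (2 * (L : ℝ)) ^ β := by
          apply Real.rpow_le_rpow (by positivity) _ hβ0
          exact_mod_cast hn'
      _ = 2 ^ β * (L : ℝ) ^ β := Real.mul_rpow (by norm_num) (by positivity)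
      _ ≤ 2 * (L : ℝ) ^ β := by
          gcongr
          simpa using Real.rpow_le_rpow_of_exponent_le (x := 2) (by norm_num) hβ1
  rw [hL]
  calc _ ≤ _ := h1
    _ ≤ C * (2 * (L : ℝ) ^ β) := by gcongr
    _ = _ := by push_cast; ring

theorem tendsto_length_intervalFilter :
    Tendsto (fun p : ℤ × ℤ => ((p.2 - p.1 : ℤ) : ℝ)) intervalFilter atTop :=
  tendsto_intCast_atTop_atTop.comp tendsto_comap

theorem tendsto_intervalFilter_of_length {ι : Type*} {l : Filter ι} {p : ι → ℤ × ℤ}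
    (h : Tendsto (fun i => (p i).2 - (p i).1) l atTop) : Tendsto p l intervalFilter :=
  tendsto_comap_iff.2 h

instance intervalFilter_neBot : intervalFilter.NeBot :=
  (tendsto_intervalFilter_of_length (p := fun n : ℤ => (0, n)) (l := atTop)
    (by simp only [sub_zero]; exact tendsto_id)).neBot

theorem eventually_length_gt (a : ℝ) :
    ∀ᶠ p : ℤ × ℤ in intervalFilter, a < ((p.2 - p.1 : ℤ) : ℝ) :=
  tendsto_length_intervalFilter.eventually_gt_atTop a

theorem eventually_logRatio_le {S : Set ℤ} {C β ε : ℝ} (hβ : 0 ≤ β) (hε : 0 < ε)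
    (hS : ∀ M N : ℤ, M < N → (icount S M N : ℝ) ≤ C * ((N - M : ℤ) : ℝ) ^ β) :
    ∀ᶠ p : ℤ × ℤ in intervalFilter,
      Real.log (icount S p.1 p.2) / Real.log ((p.2 - p.1 : ℤ) : ℝ) ≤ β + ε := by
  have hlog := Real.tendsto_log_atTop.comp tendsto_length_intervalFilter
  filter_upwards [eventually_length_gt 1, hlog.eventually_ge_atTop (Real.log C / ε)]
    with ⟨M, N⟩ h1 h2
  simp only [Function.comp] at h1 h2 ⊢
  have hpos : 0 < Real.log ((N - M : ℤ) : ℝ) := Real.log_pos h1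
  rw [div_le_iff₀ hpos]
  rcases Nat.eq_zero_or_pos (icount S M N) with h0 | h0
  · rw [h0]
    simp only [Nat.cast_zero, Real.log_zero]
    positivity
  · have hMN : M < N := by
      have : (0 : ℝ) < ((N - M : ℤ) : ℝ) := by linarith
      have : 0 < N - M := by exact_mod_cast this
      linarith
    have hle := hS M N hMN
    have hc : (0 : ℝ) < icount S M N := by exact_mod_cast h0
    have hpow : (0 : ℝ) < ((N - M : ℤ) : ℝ) ^ β := Real.rpow_pos_of_pos (by linarith) _
    have hC : 0 < C := pos_of_mul_pos_left (hc.trans_le hle) hpow.le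
    have := Real.log_le_log hc hle
    rw [Real.log_mul hC.ne' hpow.ne', Real.log_rpow (by linarith)] at this
    rw [div_le_iff₀ hε] at h2
    linarith

theorem logRatio_nonneg (S : Set ℤ) : ∀ᶠ p : ℤ × ℤ in intervalFilter,
    0 ≤ Real.log (icount S p.1 p.2) / Real.log ((p.2 - p.1 : ℤ) : ℝ) := by
  filter_upwards [eventually_length_gt 1] with p hp
  exact div_nonneg (Real.log_natCast_nonneg _) (Real.log_pos hp).le

theorem countingDim_le {S : Set ℤ} {C β : ℝ} (hβ : 0 ≤ β)
    (hS : ∀ M N : ℤ, M < N → (icount S M N : ℝ) ≤ C * ((N - M : ℤ) : ℝ) ^ β) :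
    countingDim S ≤ β := by
  refine le_of_forall_pos_le_add fun ε hε => ?_
  refine limsup_le_of_le ?_ (eventually_logRatio_le hβ hε hS)
  exact (isBoundedUnder_of_eventually_ge (logRatio_nonneg S)).isCoboundedUnder_le

theorem upperBanach_eq_zero {S : Set ℤ} {C β : ℝ} (hβ : β < 1)
    (hS : ∀ M N : ℤ, M < N → (icount S M N : ℝ) ≤ C * ((N - M : ℤ) : ℝ) ^ β) :
    upperBanach S = 0 := by
  refine Tendsto.limsup_eq ?_
  have hlim : Tendsto (fun p : ℤ × ℤ => C * ((p.2 - p.1 : ℤ) : ℝ) ^ (-(1 - β)))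
      intervalFilter (nhds 0) := by
    simpa using ((tendsto_rpow_neg_atTop (sub_pos.2 hβ)).comp
      tendsto_length_intervalFilter).const_mul C
  refine squeeze_zero' ?_ ?_ hlim
  · filter_upwards [eventually_length_gt 0] with p hp
    positivity
  · filter_upwards [eventually_length_gt 0] with p hp
    have hMN : p.1 < p.2 := by
      have : 0 < p.2 - p.1 := by exact_mod_cast hp
      linarith
    rw [div_le_iff₀ hp, mul_assoc, ← Real.rpow_add_one hp.ne']
    simpa using hS _ _ hMN

theorem le_countingDim {S : Set ℤ} {C β α : ℝ} (hβ : 0 ≤ β)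
    (hS : ∀ M N : ℤ, M < N → (icount S M N : ℝ) ≤ C * ((N - M : ℤ) : ℝ) ^ β)
    (hfreq : ∃ᶠ p : ℤ × ℤ in intervalFilter,
      ((p.2 - p.1 : ℤ) : ℝ) ^ α ≤ (icount S p.1 p.2 : ℝ)) :
    α ≤ countingDim S := by
  refine le_limsup_of_frequently_le ?_
    (isBoundedUnder_of_eventually_le (eventually_logRatio_le hβ one_pos hS))
  refine (hfreq.and_eventually (eventually_length_gt 1)).mono ?_
  rintro p ⟨h, h1⟩
  rw [le_div_iff₀ (Real.log_pos h1), ← Real.log_rpow (by linarith)]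
  exact Real.log_le_log (Real.rpow_pos_of_pos (by linarith) _) h

theorem countingMeasure_lt_top {S : Set ℤ} {C β : ℝ}
    (hS : ∀ M N : ℤ, M < N → (icount S M N : ℝ) ≤ C * ((N - M : ℤ) : ℝ) ^ β) :
    countingMeasure β S < ⊤ := by
  refine lt_of_le_of_lt (limsup_le_of_le (a := ENNReal.ofReal C) (by isBoundedDefault) ?_)
    ENNReal.ofReal_lt_top
  filter_upwards [eventually_length_gt 0] with p hp
  have hMN : p.1 < p.2 := by
    have : 0 < p.2 - p.1 := by exact_mod_cast hp
    linarith
  apply ENNReal.ofReal_le_ofReal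
  rw [div_le_iff₀ (Real.rpow_pos_of_pos hp _)]
  exact hS _ _ hMN

theorem countingMeasure_pos {S : Set ℤ} {α : ℝ}
    (hfreq : ∃ᶠ p : ℤ × ℤ in intervalFilter,
      ((p.2 - p.1 : ℤ) : ℝ) ^ α ≤ (icount S p.1 p.2 : ℝ)) :
    0 < countingMeasure α S := by
  refine lt_of_lt_of_le zero_lt_one (le_limsup_of_frequently_le ?_ (by isBoundedDefault))
  refine (hfreq.and_eventually (eventually_length_gt 0)).mono ?_
  rintro p ⟨h, h0⟩
  rw [ENNReal.one_le_ofReal, one_le_div (Real.rpow_pos_of_pos h0 _)]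
  exact h

/-- The binary digits `4 * blockIndex m, …, 4 * blockIndex (m + 1) - 1` form the `m`-th block. -/
def blockIndex (m : ℕ) : ℕ := m + padicValNat 2 m.factorial

/-- The number of binary digits forced to vanish at the bottom of the `m`-th block. -/
def gapLength (m : ℕ) : ℕ := padicValNat 2 (m + 1) + 1

theorem blockIndex_zero : blockIndex 0 = 0 := by simp [blockIndex]

theorem blockIndex_succ (m : ℕ) : blockIndex (m + 1) = blockIndex m + gapLength m := by
  rw [blockIndex, blockIndex, gapLength, Nat.factorial_succ,
    padicValNat.mul m.add_one_ne_zero m.factorial_ne_zero]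
  omega

theorem gapLength_pos (m : ℕ) : 0 < gapLength m := Nat.succ_pos _

theorem le_blockIndex (m : ℕ) : m ≤ blockIndex m := Nat.le_add_right _ _

theorem blockIndex_le (m : ℕ) : blockIndex m ≤ 2 * m := by
  have := padicValNat_factorial_le (p := 2) m
  unfold blockIndex
  omega

theorem blockIndex_monotone : Monotone blockIndex :=
  monotone_nat_of_le_succ fun m => by rw [blockIndex_succ]; omega

theorem exists_block (n : ℕ) : ∃ m, 4 * blockIndex m ≤ n ∧ n < 4 * blockIndex (m + 1) := by
  induction n with
  | zero => exact ⟨0, by simp [blockIndex_zero], by rw [blockIndex_succ]; simp [gapLength_pos]⟩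
  | succ n ih =>
    obtain ⟨m, h1, h2⟩ := ih
    rcases Nat.lt_or_ge (n + 1) (4 * blockIndex (m + 1)) with h | h
    · exact ⟨m, by omega, h⟩
    · refine ⟨m + 1, h, ?_⟩
      have := blockIndex_succ (m + 1)
      have := gapLength_pos (m + 1)
      omega

/-- The integers whose binary digits vanish in the bottom quarter of each block. -/
def gappedSet : Set ℤ :=
  {x | ∀ m, x % 2 ^ (4 * blockIndex m + gapLength m) < 2 ^ (4 * blockIndex m)}

theorem residues_gappedSet_subset {m s : ℕ} (hs : s ≤ gapLength m) :
    residues gappedSet (4 * blockIndex m + s) ⊆ residues gappedSet (4 * blockIndex m) := by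
  rintro _ ⟨x, hx, rfl⟩
  refine ⟨x, hx, ?_⟩
  have h0 := Int.emod_nonneg x (b := 2 ^ (4 * blockIndex m + gapLength m)) (by positivity)
  have h1 : ∀ t ≤ gapLength m, x % 2 ^ (4 * blockIndex m + t) =
      x % 2 ^ (4 * blockIndex m + gapLength m) := by
    intro t ht
    rw [← Int.emod_emod_of_dvd x (pow_dvd_pow 2 (Nat.add_le_add_left ht _))]
    refine Int.emod_eq_of_lt h0 ((hx m).trans_le ?_)
    exact pow_le_pow_right₀ one_le_two (Nat.le_add_right _ _)
  exact (h1 0 (Nat.zero_le _)).trans (h1 s hs).symm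

theorem ncard_residues_gappedSet_add_le (m s : ℕ) :
    (residues gappedSet (4 * blockIndex m + s)).ncard ≤
      2 ^ (s - gapLength m) * (residues gappedSet (4 * blockIndex m)).ncard := by
  rcases le_total s (gapLength m) with h | h
  · rw [Nat.sub_eq_zero_of_le h, pow_zero, one_mul]
    exact Set.ncard_le_ncard (residues_gappedSet_subset h) (residues_finite _ _)
  · obtain ⟨q, rfl⟩ := Nat.exists_eq_add_of_le h
    rw [Nat.add_sub_cancel_left, ← add_assoc]
    refine (ncard_residues_add_le _ _ q).trans (Nat.mul_le_mul_left _ ?_)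
    exact Set.ncard_le_ncard (residues_gappedSet_subset le_rfl) (residues_finite _ _)

theorem ncard_residues_gappedSet_block_le (m : ℕ) :
    (residues gappedSet (4 * blockIndex m)).ncard ≤ 2 ^ (3 * blockIndex m) := by
  induction m with
  | zero => simpa [blockIndex_zero] using ncard_residues_zero_le gappedSet
  | succ m ih =>
    rw [blockIndex_succ, mul_add, mul_add]
    calc _ ≤ _ := ncard_residues_gappedSet_add_le m _
      _ ≤ 2 ^ (4 * gapLength m - gapLength m) * 2 ^ (3 * blockIndex m) := by gcongr
      _ = _ := by
        rw [← pow_add]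
        congr 1
        omega

theorem ncard_residues_gappedSet_le (n : ℕ) :
    ((residues gappedSet n).ncard : ℝ) ≤ 1 * (2 : ℝ) ^ ((3 / 4 : ℝ) * n) := by
  obtain ⟨m, h1, h2⟩ := exists_block n
  obtain ⟨s, rfl⟩ := Nat.exists_eq_add_of_le h1
  rw [blockIndex_succ] at h2
  have h : (residues gappedSet (4 * blockIndex m + s)).ncard ≤
      2 ^ (s - gapLength m + 3 * blockIndex m) := by
    rw [pow_add]
    exact (ncard_residues_gappedSet_add_le m s).trans
      (Nat.mul_le_mul_left _ (ncard_residues_gappedSet_block_le m))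
  have he : 4 * (s - gapLength m + 3 * blockIndex m) ≤ 3 * (4 * blockIndex m + s) := by omega
  have he' : (4 : ℝ) * ((s - gapLength m + 3 * blockIndex m : ℕ) : ℝ) ≤
      3 * ((4 * blockIndex m + s : ℕ) : ℝ) := by exact_mod_cast he
  calc _ ≤ ((2 : ℝ) ^ (s - gapLength m + 3 * blockIndex m)) := by exact_mod_cast h
    _ = (2 : ℝ) ^ ((s - gapLength m + 3 * blockIndex m : ℕ) : ℝ) := (Real.rpow_natCast _ _).symm
    _ ≤ _ := by
      rw [one_mul]
      exact Real.rpow_le_rpow_of_exponent_le one_le_two (by linarith)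

theorem add_mul_mem_gappedSet {m : ℕ} {x t : ℤ} (hx : x ∈ gappedSet) (hx0 : 0 ≤ x)
    (hx1 : x < 2 ^ (4 * blockIndex m)) (ht0 : 0 ≤ t) (ht1 : t < 2 ^ (3 * gapLength m)) :
    x + 2 ^ (4 * blockIndex m + gapLength m) * t ∈ gappedSet ∧
      x + 2 ^ (4 * blockIndex m + gapLength m) * t < 2 ^ (4 * blockIndex (m + 1)) := by
  have hlt : x + 2 ^ (4 * blockIndex m + gapLength m) * t < 2 ^ (4 * blockIndex (m + 1)) := by
    have h1 : (2 : ℤ) ^ (4 * blockIndex m) ≤ 2 ^ (4 * blockIndex m + gapLength m) :=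
      pow_le_pow_right₀ one_le_two (Nat.le_add_right _ _)
    have h2 : (2 : ℤ) ^ (4 * blockIndex (m + 1)) =
        2 ^ (4 * blockIndex m + gapLength m) * 2 ^ (3 * gapLength m) := by
      rw [← pow_add, blockIndex_succ]
      congr 1
      omega
    have h3 : (0 : ℤ) < 2 ^ (4 * blockIndex m + gapLength m) := by positivity
    rw [h2]
    nlinarith
  refine ⟨fun j => ?_, hlt⟩
  rcases le_or_gt j m with hj | hj
  · have hdvd : (2 : ℤ) ^ (4 * blockIndex j + gapLength j) ∣
        2 ^ (4 * blockIndex m + gapLength m) := by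
      apply pow_dvd_pow
      rcases hj.eq_or_lt with rfl | hj
      · exact le_rfl
      · have h1 := blockIndex_monotone hj
        rw [Nat.succ_eq_add_one, blockIndex_succ] at h1
        omega
    obtain ⟨c, hc⟩ := hdvd
    rw [hc, mul_assoc, Int.add_mul_emod_self_left]
    exact hx j
  · have hle : (2 : ℤ) ^ (4 * blockIndex (m + 1)) ≤ 2 ^ (4 * blockIndex j) :=
      pow_le_pow_right₀ one_le_two (Nat.mul_le_mul_left _ (blockIndex_monotone hj))
    have hle' : (2 : ℤ) ^ (4 * blockIndex j) ≤ 2 ^ (4 * blockIndex j + gapLength j) :=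
      pow_le_pow_right₀ one_le_two (Nat.le_add_right _ _)
    rw [Int.emod_eq_of_lt (by positivity) (hlt.trans_le (hle.trans hle'))]
    exact hlt.trans_le hle

theorem le_ncard_gappedSet_inter_Ico (m : ℕ) :
    2 ^ (3 * blockIndex m) ≤ (gappedSet ∩ Set.Ico 0 (2 ^ (4 * blockIndex m))).ncard := by
  induction m with
  | zero =>
    have h : gappedSet ∩ Set.Ico 0 (2 ^ (4 * blockIndex 0)) = {0} := by
      ext x
      simp only [blockIndex_zero, Set.mem_inter_iff, Set.mem_Ico, Set.mem_singleton_iff]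
      refine ⟨fun h => ?_, ?_⟩
      · norm_num at h
        omega
      · rintro rfl
        exact ⟨fun j => by simp, by simp⟩
    rw [h]
    simp [blockIndex_zero]
  | succ m ih =>
    have hcard : (Set.Ico (0 : ℤ) (2 ^ (3 * gapLength m))).ncard = 2 ^ (3 * gapLength m) := by
      rw [← Finset.coe_Ico, Set.ncard_coe_finset, Int.card_Ico, sub_zero]
      exact_mod_cast Int.toNat_natCast (2 ^ (3 * gapLength m))
    calc 2 ^ (3 * blockIndex (m + 1))
        = 2 ^ (3 * blockIndex m) * 2 ^ (3 * gapLength m) := by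
          rw [← pow_add, blockIndex_succ, mul_add]
      _ ≤ (gappedSet ∩ Set.Ico 0 (2 ^ (4 * blockIndex m))).ncard *
            (Set.Ico (0 : ℤ) (2 ^ (3 * gapLength m))).ncard := by
          rw [hcard]
          gcongr
      _ = ((gappedSet ∩ Set.Ico 0 (2 ^ (4 * blockIndex m))) ×ˢ
            Set.Ico (0 : ℤ) (2 ^ (3 * gapLength m))).ncard := Set.ncard_prod.symm
      _ ≤ _ := by
          refine Set.ncard_le_ncard_of_injOn
            (fun z => z.1 + 2 ^ (4 * blockIndex m + gapLength m) * z.2) ?_ ?_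
            ((Set.finite_Ico _ _).inter_of_right _)
          · rintro ⟨x, t⟩ ⟨⟨hx, hx0, hx1⟩, ht0, ht1⟩
            have h := add_mul_mem_gappedSet hx hx0 hx1 ht0 ht1
            exact ⟨h.1, by simp only at hx0 ht0 ⊢; positivity, h.2⟩
          · rintro ⟨x, t⟩ ⟨⟨-, hx0, hx1⟩, -⟩ ⟨y, u⟩ ⟨⟨-, hy0, hy1⟩, -⟩ h
            simp only at hx0 hx1 hy0 hy1 h
            have hle : (2 : ℤ) ^ (4 * blockIndex m) ≤ 2 ^ (4 * blockIndex m + gapLength m) :=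
              pow_le_pow_right₀ one_le_two (Nat.le_add_right _ _)
            have hxy : x = y := by
              have := congrArg (· % (2 : ℤ) ^ (4 * blockIndex m + gapLength m)) h
              simpa only [Int.add_mul_emod_self_left, Int.emod_eq_of_lt hx0 (hx1.trans_le hle),
                Int.emod_eq_of_lt hy0 (hy1.trans_le hle)] using this
            subst hxy
            have := mul_left_cancel₀ (by positivity) (add_left_cancel h)
            rw [this]

theorem frequently_rpow_le_icount_gappedSet : ∃ᶠ p : ℤ × ℤ in intervalFilter,
    ((p.2 - p.1 : ℤ) : ℝ) ^ (3 / 4 : ℝ) ≤ (icount gappedSet p.1 p.2 : ℝ) := by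
  have ht : Tendsto (fun m : ℕ => ((-1, 2 ^ (4 * blockIndex m) - 1) : ℤ × ℤ))
      atTop intervalFilter := by
    refine tendsto_intervalFilter_of_length (tendsto_atTop_mono (fun m : ℕ => ?_)
      tendsto_natCast_atTop_atTop)
    have h1 : m < 2 ^ m := Nat.lt_two_pow_self
    have h2 : 2 ^ m ≤ 2 ^ (4 * blockIndex m) :=
      Nat.pow_le_pow_right two_pos (by have := le_blockIndex m; omega)
    have h3 : (m : ℤ) ≤ 2 ^ (4 * blockIndex m) := by exact_mod_cast h1.le.trans h2
    simpa using h3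
  refine ht.frequently (Frequently.of_forall fun m => ?_)
  have hI : Set.Ioc (-1 : ℤ) (2 ^ (4 * blockIndex m) - 1) =
      Set.Ico 0 (2 ^ (4 * blockIndex m)) := by
    ext x
    simp only [Set.mem_Ioc, Set.mem_Ico]
    omega
  have h := le_ncard_gappedSet_inter_Ico m
  rw [← hI] at h
  refine le_trans (le_of_eq ?_) (Nat.cast_le.2 h)
  have hlen : (2 : ℤ) ^ (4 * blockIndex m) - 1 - -1 = 2 ^ (4 * blockIndex m) := by ring
  rw [hlen]
  push_cast
  rw [← Real.rpow_natCast, ← Real.rpow_natCast,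
    ← Real.rpow_mul (by norm_num)]
  congr 1
  push_cast
  ring

theorem ncard_residues_add_two_le_of_near_multiple {S : Set ℤ} {q : ℕ}
    (hS : ∀ s ∈ S, ∃ u : ℤ, s % 2 ^ (q + 2) = u % 2 ^ (q + 2) ∧ -2 ^ q ≤ u ∧ u < 2 ^ q) :
    (residues S (q + 2)).ncard ≤ 2 * (residues S q).ncard := by
  have h : residues S (q + 2) ⊆ residues S q ∪ (fun r => r + 3 * 2 ^ q) '' residues S q := by
    rintro _ ⟨s, hs, rfl⟩
    obtain ⟨u, hu, hu0, hu1⟩ := hS s hs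
    have hpos : (0 : ℤ) < 2 ^ q := by positivity
    have hmod : s % 2 ^ q = u % 2 ^ q := by
      rw [← Int.emod_emod_of_dvd s (pow_dvd_pow 2 (Nat.le_add_right q 2)), hu,
        Int.emod_emod_of_dvd u (pow_dvd_pow 2 (Nat.le_add_right q 2))]
    have hpow : (2 : ℤ) ^ (q + 2) = 4 * 2 ^ q := by ring
    rcases le_or_gt 0 u with h | h
    · refine Or.inl ⟨s, hs, ?_⟩
      simp only
      rw [hmod, hu, Int.emod_eq_of_lt h hu1, Int.emod_eq_of_lt h (by linarith)]
    · refine Or.inr ⟨_, ⟨s, hs, rfl⟩, ?_⟩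
      simp only
      rw [hmod, hu, ← Int.add_emod_right u (2 ^ q), ← Int.add_emod_right u (2 ^ (q + 2)),
        Int.emod_eq_of_lt (by linarith) (by linarith),
        Int.emod_eq_of_lt (by linarith) (by linarith), hpow]
      ring
  calc _ ≤ _ := Set.ncard_le_ncard h
        ((residues_finite S q).union ((residues_finite S q).image _))
    _ ≤ _ := Set.ncard_union_le _ _
    _ ≤ _ := by
      have := Set.ncard_image_le (f := fun r : ℤ => r + 3 * 2 ^ q) (residues_finite S q)
      omega

/-- The sum set `E + l * E` of a set of integers. -/
def dilateSum (E : Set ℤ) (l : ℤ) : Set ℤ := {n | ∃ a ∈ E, ∃ b ∈ E, n = a + l * b}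

theorem ncard_residues_dilateSum_le_of_long_gap {l : ℤ} {m : ℕ}
    (hm : l.natAbs + 2 ≤ gapLength m) :
    (residues (dilateSum gappedSet l) (4 * blockIndex m + gapLength m)).ncard * 2 ≤
      2 ^ gapLength m * (residues (dilateSum gappedSet l) (4 * blockIndex m)).ncard := by
  obtain ⟨g, hg⟩ := Nat.exists_eq_add_of_le' (show 2 ≤ gapLength m by omega)
  have key := ncard_residues_add_two_le_of_near_multiple (S := dilateSum gappedSet l)
    (q := 4 * blockIndex m + g) ?_
  · have h := ncard_residues_add_le (dilateSum gappedSet l) (4 * blockIndex m) g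
    rw [hg, ← add_assoc, pow_add]
    linarith
  · rintro _ ⟨x, hx, y, hy, rfl⟩
    have hx1 := hx m
    have hy1 := hy m
    rw [hg, ← add_assoc] at hx1 hy1
    have hx0 := Int.emod_nonneg x (b := 2 ^ (4 * blockIndex m + g + 2)) (by positivity)
    have hy0 := Int.emod_nonneg y (b := 2 ^ (4 * blockIndex m + g + 2)) (by positivity)
    refine ⟨x % 2 ^ (4 * blockIndex m + g + 2) + l * (y % 2 ^ (4 * blockIndex m + g + 2)),
      ?_, ?_⟩
    · simp [Int.add_emod, Int.mul_emod]
    · have hl : |l| + 1 ≤ 2 ^ g := by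
        have h1 : l.natAbs < 2 ^ l.natAbs := Nat.lt_two_pow_self
        have h2 : 2 ^ l.natAbs ≤ 2 ^ g := Nat.pow_le_pow_right two_pos (by omega)
        rw [Int.abs_eq_natAbs]
        exact_mod_cast (Nat.succ_le_of_lt h1).trans h2
      have hP : (0 : ℤ) < 2 ^ (4 * blockIndex m) := by positivity
      generalize x % 2 ^ (4 * blockIndex m + g + 2) = a at *
      generalize y % 2 ^ (4 * blockIndex m + g + 2) = b at *
      rw [pow_add]
      have h1 : |l * b| ≤ |l| * 2 ^ (4 * blockIndex m) := by
        rw [abs_mul, abs_of_nonneg hy0]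
        gcongr
      have h2 : (|l| + 1) * 2 ^ (4 * blockIndex m) ≤ 2 ^ g * 2 ^ (4 * blockIndex m) := by
        gcongr
      have h3 := abs_le.1 h1
      constructor <;> nlinarith

theorem ncard_residues_dilateSum_block_le (l : ℤ) (m : ℕ) :
    (residues (dilateSum gappedSet l) (4 * blockIndex m)).ncard *
      2 ^ (m / 2 ^ (l.natAbs + 1)) ≤ 2 ^ (4 * blockIndex m) := by
  induction m with
  | zero => simpa [blockIndex_zero] using ncard_residues_zero_le (dilateSum gappedSet l)
  | succ m ih =>
    rw [blockIndex_succ, Nat.succ_div, mul_add]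
    split_ifs with h
    · have hgap : l.natAbs + 2 ≤ gapLength m := by
        have := (padicValNat_dvd_iff_le m.add_one_ne_zero).1 h
        unfold gapLength
        omega
      have h1 := ncard_residues_dilateSum_le_of_long_gap hgap
      have h2 := ncard_residues_add_le (dilateSum gappedSet l)
        (4 * blockIndex m + gapLength m) (3 * gapLength m)
      have h3 : 4 * blockIndex m + gapLength m + 3 * gapLength m =
        4 * blockIndex m + 4 * gapLength m := by omega
      rw [h3] at h2
      calc _ ≤ 2 ^ (3 * gapLength m) * (residues (dilateSum gappedSet l)
              (4 * blockIndex m + gapLength m)).ncard *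
              2 ^ (m / 2 ^ (l.natAbs + 1) + 1) := by gcongr
        _ = 2 ^ (3 * gapLength m) * ((residues (dilateSum gappedSet l)
              (4 * blockIndex m + gapLength m)).ncard * 2) *
              2 ^ (m / 2 ^ (l.natAbs + 1)) := by ring
        _ ≤ 2 ^ (3 * gapLength m) * (2 ^ gapLength m *
              (residues (dilateSum gappedSet l) (4 * blockIndex m)).ncard) *
              2 ^ (m / 2 ^ (l.natAbs + 1)) := by gcongr
        _ = 2 ^ (4 * gapLength m) * ((residues (dilateSum gappedSet l)
              (4 * blockIndex m)).ncard * 2 ^ (m / 2 ^ (l.natAbs + 1))) := by ring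
        _ ≤ 2 ^ (4 * gapLength m) * 2 ^ (4 * blockIndex m) := by gcongr
        _ = _ := by ring
    · have h2 := ncard_residues_add_le (dilateSum gappedSet l)
        (4 * blockIndex m) (4 * gapLength m)
      calc _ ≤ 2 ^ (4 * gapLength m) * (residues (dilateSum gappedSet l)
              (4 * blockIndex m)).ncard * 2 ^ (m / 2 ^ (l.natAbs + 1)) := by
            rw [add_zero]
            gcongr
        _ ≤ 2 ^ (4 * gapLength m) * 2 ^ (4 * blockIndex m) := by
            rw [mul_assoc]
            gcongr
        _ = _ := by ring

theorem ncard_residues_dilateSum_le (l : ℤ) (n : ℕ) :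
    ((residues (dilateSum gappedSet l) n).ncard : ℝ) ≤
      2 * (2 : ℝ) ^ ((1 - 1 / (8 * 2 ^ (l.natAbs + 1)) : ℝ) * n) := by
  obtain ⟨m, h1, h2⟩ := exists_block n
  have hm : n ≤ 8 * (m + 1) := by
    have := blockIndex_le (m + 1)
    omega
  obtain ⟨s, rfl⟩ := Nat.exists_eq_add_of_le h1
  set T := 2 ^ (l.natAbs + 1) with hT
  have hT0 : 0 < T := by positivity
  have hcard : (residues (dilateSum gappedSet l) (4 * blockIndex m + s)).ncard * 2 ^ (m / T) ≤
      2 ^ (4 * blockIndex m + s) := by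
    calc _ ≤ 2 ^ s * (residues (dilateSum gappedSet l) (4 * blockIndex m)).ncard *
            2 ^ (m / T) := by
          gcongr
          exact ncard_residues_add_le _ _ s
      _ ≤ 2 ^ s * 2 ^ (4 * blockIndex m) := by
          rw [mul_assoc]
          gcongr
          exact ncard_residues_dilateSum_block_le l m
      _ = _ := by ring
  generalize 4 * blockIndex m + s = n at *
  have hdiv : n ≤ 8 * T * (m / T + 1) := by
    have := Nat.lt_mul_div_succ m hT0
    nlinarith
  have hdiv' : (n : ℝ) / (8 * T) ≤ ((m / T : ℕ) : ℝ) + 1 := by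
    rw [div_le_iff₀ (by positivity), mul_comm]
    exact_mod_cast hdiv
  have hcard' : ((residues (dilateSum gappedSet l) n).ncard : ℝ) *
      (2 : ℝ) ^ ((m / T : ℕ) : ℝ) ≤ (2 : ℝ) ^ (n : ℝ) := by
    rw [Real.rpow_natCast, Real.rpow_natCast]
    exact_mod_cast hcard
  have hTcast : (2 : ℝ) ^ (l.natAbs + 1) = (T : ℝ) := by simp [hT]
  rw [hTcast]
  rw [← le_div_iff₀ (by positivity), ← Real.rpow_sub two_pos] at hcard'
  refine hcard'.trans ?_
  calc _ ≤ (2 : ℝ) ^ (1 + (1 - 1 / (8 * T) : ℝ) * n) := by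
        apply Real.rpow_le_rpow_of_exponent_le one_le_two
        have : (1 - 1 / (8 * T) : ℝ) * n = n - n / (8 * T) := by ring
        linarith
    _ = _ := by rw [Real.rpow_add two_pos, Real.rpow_one]

/-- **Subsection 4.4 counterexample.** There is a regular set `E ⊆ ℤ` with
`1/2 < D(E) < 1` such that `D(E + λ E) < 1` for every integer `λ`; in particular
`E + λ E` has zero upper-Banach density for every `λ ∈ ℤ`, although
`D(E) + D(E) > 1`. -/
theorem counterexample_integer_parameters :
    ∃ E : Set ℤ, Regular E ∧ 1 / 2 < countingDim E ∧ countingDim E < 1 ∧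
      (∀ l : ℤ, countingDim {n : ℤ | ∃ a ∈ E, ∃ b ∈ E, n = a + l * b} < 1) ∧
      (∀ l : ℤ, upperBanach {n : ℤ | ∃ a ∈ E, ∃ b ∈ E, n = a + l * b} = 0) ∧
      1 < countingDim E + countingDim E := by
  have hE : ∀ M N : ℤ, M < N →
      (icount gappedSet M N : ℝ) ≤ 2 * 1 * ((N - M : ℤ) : ℝ) ^ (3 / 4 : ℝ) :=
    fun M N => icount_le_mul_rpow (by norm_num) (by norm_num) ncard_residues_gappedSet_le
  have hdim : countingDim gappedSet = 3 / 4 :=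
    le_antisymm (countingDim_le (by norm_num) hE)
      (le_countingDim (by norm_num) hE frequently_rpow_le_icount_gappedSet)
  have hexp : ∀ l : ℤ, 0 ≤ (1 - 1 / (8 * 2 ^ (l.natAbs + 1)) : ℝ) ∧
      (1 - 1 / (8 * 2 ^ (l.natAbs + 1)) : ℝ) < 1 := by
    intro l
    have h1 : (1 : ℝ) ≤ 2 ^ (l.natAbs + 1) := one_le_pow₀ one_le_two
    refine ⟨?_, sub_lt_self _ (by positivity)⟩
    rw [sub_nonneg, div_le_one (by positivity)]
    linarith
  have hsum := fun l M N => icount_le_mul_rpow (M := M) (N := N) (hexp l).1 (hexp l).2.le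
    (ncard_residues_dilateSum_le l)
  refine ⟨gappedSet, ?_, ?_, ?_, fun l => ?_, fun l => ?_, ?_⟩
  · rw [Regular, hdim]
    exact ⟨countingMeasure_pos frequently_rpow_le_icount_gappedSet, countingMeasure_lt_top hE⟩
  · rw [hdim]; norm_num
  · rw [hdim]; norm_num
  · exact (countingDim_le (hexp l).1 (hsum l)).trans_lt (hexp l).2
  · exact upperBanach_eq_zero (hexp l).2 (hsum l)
  · rw [hdim]; norm_num
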